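/- Let Z be a nonempty finite type, let a and b be pmfs on Z with disjoint supports (for every z, a z = 0 or b z = 0), let r be a pmf on Z with r z > 0 for all z, and let d be a real number with 0 < d < 1. Then the KL divergence of the mixture from r decomposes as ∑ z, (d * a z + (1 - d) * b z) * Real.log ((d * a z + (1 - d) * b z) / r z) = d * (∑ z, a z * Real.log (a z / r z)) + (1 - d) * (∑ z, b z * Real.log (b z / r z)) + d * Real.log d + (1 - d) * Real.log (1 - d). -/

import Mathlib

/-- Scaling identity for a single KL term. -/
theorem kl_term_scale (c x r : ℝ) (hc : c ≠ 0) (hr : r ≠ 0) :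
    (c * x) * Real.log (c * x / r) =
      c * (x * Real.log (x / r)) + (c * Real.log c) * x := by
  by_cases hx : x = 0
  · simp [hx]
  · rw [mul_div_assoc, Real.log_mul hc (div_ne_zero hx hr)]
    ring

/-- Decomposition of the KL divergence of a mixture of two pmfs with disjoint
supports from a positive prior `r`: it splits into the weighted KL divergences
of the components plus the (negative) binary entropy of the mixture weight. -/
theorem kl_mixture_disjoint_support_decomposition
    {Z : Type*} [Fintype Z] [Nonempty Z]
    (a : Z → ℝ) (ha0 : ∀ z, 0 ≤ a z) (ha1 : ∑ z, a z = 1)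
    (b : Z → ℝ) (hb0 : ∀ z, 0 ≤ b z) (hb1 : ∑ z, b z = 1)
    (hdisj : ∀ z, a z = 0 ∨ b z = 0)
    (r : Z → ℝ) (hr0 : ∀ z, 0 < r z) (hr1 : ∑ z, r z = 1)
    (d : ℝ) (hd0 : 0 < d) (hd1 : d < 1) :
    ∑ z, (d * a z + (1 - d) * b z) *
        Real.log ((d * a z + (1 - d) * b z) / r z) =
      d * (∑ z, a z * Real.log (a z / r z)) +
        (1 - d) * (∑ z, b z * Real.log (b z / r z)) +
        d * Real.log d + (1 - d) * Real.log (1 - d) := by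
  have key : ∀ z, (d * a z + (1 - d) * b z) *
        Real.log ((d * a z + (1 - d) * b z) / r z) =
      d * (a z * Real.log (a z / r z)) + (1 - d) * (b z * Real.log (b z / r z)) +
        (d * Real.log d) * a z + ((1 - d) * Real.log (1 - d)) * b z := by
    intro z
    rcases hdisj z with h | h
    · have := kl_term_scale (1 - d) (b z) (r z) (sub_pos.2 hd1).ne' (hr0 z).ne'
      simp only [h, mul_zero, zero_add, zero_mul, add_zero]
      exact this
    · have := kl_term_scale d (a z) (r z) hd0.ne' (hr0 z).ne'
      simp only [h, mul_zero, zero_mul, add_zero]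
      exact this
  rw [Finset.sum_congr rfl fun z _ => key z]
  simp only [Finset.sum_add_distrib, ← Finset.mul_sum, ha1, hb1, mul_one]
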